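/- Suppose η is real and all inhomogeneities η₁,…,η_N are purely imaginary. Then for every λ ∈ ℂ the antiperiodic transfer matrix T̄(λ) = B(λ)+C(λ) is a normal operator on H, and for every λ ∈ ℂ satisfying λ + λ̄ + η = 0 the operator i^{e_N}·T̄(λ) is self-adjoint, where e_N = 1 if N is even and e_N = 0 if N is odd. Moreover the Hermitian conjugate of the monodromy matrix is given entrywise by A(λ)† = (−1)^N D(−(λ̄+η)), B(λ)† = −(−1)^N C(−(λ̄+η)), C(λ)† = −(−1)^N B(−(λ̄+η)), D(λ)† = (−1)^N A(−(λ̄+η)). -/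

import Mathlib

open Matrix BigOperators Finset

noncomputable section

namespace AntiperiodicXXX

/-- `S^z` for the spin-`s` representation with `2s = m`, acting on `ℂ^{m+1}`:
`S^z = diag(s, s-1, …, -s)`. -/
def Sz (m : ℕ) : Matrix (Fin (m + 1)) (Fin (m + 1)) ℂ :=
  Matrix.diagonal fun i => (m : ℂ) / 2 - (i : ℕ)

/-- `S^+` for spin `s = m/2`: superdiagonal entries `x(j) = √(j(2s+1−j))`. -/
def Splus (m : ℕ) : Matrix (Fin (m + 1)) (Fin (m + 1)) ℂ :=
  Matrix.of fun i j =>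
    if (i : ℕ) + 1 = (j : ℕ) then
      ((Real.sqrt (((i : ℕ) + 1) * (m - (i : ℕ))) : ℝ) : ℂ)
    else 0

/-- `S^- = (S^+)^T`. -/
def Sminus (m : ℕ) : Matrix (Fin (m + 1)) (Fin (m + 1)) ℂ := (Splus m)ᵀ

/-- The Lax operator `L^{(1/2,s)}(λ)` on `ℂ² ⊗ ℂ^{m+1}` in 2×2 block form
`[[λ+η(1/2+S^z), ηS^-], [ηS^+, λ+η(1/2−S^z)]]`. -/
def Lax (η : ℂ) (m : ℕ) (lam : ℂ) :
    Matrix (Fin 2 × Fin (m + 1)) (Fin 2 × Fin (m + 1)) ℂ :=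
  Matrix.of fun p q =>
    (![![(lam + η / 2) • (1 : Matrix (Fin (m + 1)) (Fin (m + 1)) ℂ) + η • Sz m,
        η • Sminus m],
       ![η • Splus m,
        (lam + η / 2) • (1 : Matrix (Fin (m + 1)) (Fin (m + 1)) ℂ) - η • Sz m]]
      p.1 q.1) p.2 q.2

/-- The rational 6-vertex R-matrix `[[λ+η,0,0,0],[0,λ,η,0],[0,η,λ,0],[0,0,0,λ+η]]`
on `ℂ² ⊗ ℂ²`. -/
def Rmat (η lam : ℂ) : Matrix (Fin 2 × Fin 2) (Fin 2 × Fin 2) ℂ :=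
  Matrix.of fun p q =>
    if p = q then (if p.1 = p.2 then lam + η else lam)
    else if p.1 = q.2 ∧ p.2 = q.1 ∧ p.1 ≠ p.2 then η else 0

variable {N : ℕ}

/-- Index type of the quantum space `H = ⊗_{n=1}^N ℂ^{2s_n+1}` (with `m n = 2s_n`). -/
abbrev HIdx (m : Fin N → ℕ) := (n : Fin N) → Fin (m n + 1)

/-- The Lax operator `L^{(1/2,s_n)}_{0n}(λ−η_n)` at site `n` acting on `ℂ² ⊗ H`
(identity on the other tensor factors of `H`). -/
def siteL (η : ℂ) (m : Fin N → ℕ) (inh : Fin N → ℂ) (lam : ℂ) (n : Fin N) :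
    Matrix (Fin 2 × HIdx m) (Fin 2 × HIdx m) ℂ :=
  Matrix.of fun p q =>
    Lax η (m n) (lam - inh n) (p.1, p.2 n) (q.1, q.2 n) *
      (if ∀ k, k ≠ n → p.2 k = q.2 k then 1 else 0)

/-- The monodromy matrix `M₀(λ) = L_{0N}(λ−η_N) ⋯ L_{01}(λ−η₁)` on `ℂ² ⊗ H`. -/
def Mono (η : ℂ) (m : Fin N → ℕ) (inh : Fin N → ℂ) (lam : ℂ) :
    Matrix (Fin 2 × HIdx m) (Fin 2 × HIdx m) ℂ :=
  ((List.ofFn fun n : Fin N => siteL η m inh lam n).reverse).prod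

/-- `A(λ)`: entry `(0,0)` of the monodromy matrix. -/
def EntA (η : ℂ) (m : Fin N → ℕ) (inh : Fin N → ℂ) (lam : ℂ) :
    Matrix (HIdx m) (HIdx m) ℂ :=
  Matrix.of fun f g => Mono η m inh lam (0, f) (0, g)

/-- `B(λ)`: entry `(0,1)` of the monodromy matrix. -/
def EntB (η : ℂ) (m : Fin N → ℕ) (inh : Fin N → ℂ) (lam : ℂ) :
    Matrix (HIdx m) (HIdx m) ℂ :=
  Matrix.of fun f g => Mono η m inh lam (0, f) (1, g)

/-- `C(λ)`: entry `(1,0)` of the monodromy matrix. -/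
def EntC (η : ℂ) (m : Fin N → ℕ) (inh : Fin N → ℂ) (lam : ℂ) :
    Matrix (HIdx m) (HIdx m) ℂ :=
  Matrix.of fun f g => Mono η m inh lam (1, f) (0, g)

/-- `D(λ)`: entry `(1,1)` of the monodromy matrix. -/
def EntD (η : ℂ) (m : Fin N → ℕ) (inh : Fin N → ℂ) (lam : ℂ) :
    Matrix (HIdx m) (HIdx m) ℂ :=
  Matrix.of fun f g => Mono η m inh lam (1, f) (1, g)

/-- The antiperiodic transfer matrix `T̄(λ) = B(λ) + C(λ)`. -/
def Tbar (η : ℂ) (m : Fin N → ℕ) (inh : Fin N → ℂ) (lam : ℂ) :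
    Matrix (HIdx m) (HIdx m) ℂ :=
  EntB η m inh lam + EntC η m inh lam

/-- `a(λ) = −∏_{n=1}^N (λ − η_n^− + s_n η)`, with `η_n^− = η_n − η/2`. -/
def af (η : ℂ) (m : Fin N → ℕ) (inh : Fin N → ℂ) (lam : ℂ) : ℂ :=
  -∏ n, (lam - (inh n - η / 2) + (m n : ℂ) / 2 * η)

/-- `d(λ) = ∏_{n=1}^N (λ − η_n^− − s_n η)`. -/
def df (η : ℂ) (m : Fin N → ℕ) (inh : Fin N → ℂ) (lam : ℂ) : ℂ :=
  ∏ n, (lam - (inh n - η / 2) - (m n : ℂ) / 2 * η)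

/-- `η_n^{(k)} = η_n^− + (s_n − k)η`. -/
def etaK (η : ℂ) (m : Fin N → ℕ) (inh : Fin N → ℂ) (n : Fin N) (k : ℕ) : ℂ :=
  (inh n - η / 2) + ((m n : ℂ) / 2 - (k : ℂ)) * η

/-- The reference state `|0⟩ = ⊗_n (1,0,…,0)^T` (the same components give `⟨0|`). -/
def vac (m : Fin N → ℕ) : HIdx m → ℂ :=
  fun f => if ∀ n, f n = (0 : Fin (m n + 1)) then 1 else 0

/-- The Vandermonde-type coefficient `∏_{1≤b<a≤N} (η_a^{(h_a)} − η_b^{(h_b)})`. -/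
def vdm (η : ℂ) (m : Fin N → ℕ) (inh : Fin N → ℂ) (h : HIdx m) : ℂ :=
  ∏ a, ∏ b ∈ Finset.Iio a, (etaK η m inh a (h a) - etaK η m inh b (h b))

/-- The normalization `𝓃 = ∏_{1≤b<a≤N} (η_a^{(0)} − η_b^{(0)})^{1/2}`. -/
def nrm (η : ℂ) (m : Fin N → ℕ) (inh : Fin N → ℂ) : ℂ :=
  ∏ a, ∏ b ∈ Finset.Iio a, (etaK η m inh a 0 - etaK η m inh b 0) ^ ((1 : ℂ) / 2)

/-- The operator `∏_{n=1}^N ∏_{k_n=0}^{h_n−1} C(η_n^{(k_n)})/d(η_n^{(k_n+1)})`. -/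
def leftOp (η : ℂ) (m : Fin N → ℕ) (inh : Fin N → ℂ) (h : HIdx m) :
    Matrix (HIdx m) (HIdx m) ℂ :=
  (List.ofFn fun n : Fin N =>
    (List.ofFn fun k : Fin (h n : ℕ) =>
      (df η m inh (etaK η m inh n ((k : ℕ) + 1)))⁻¹ •
        EntC η m inh (etaK η m inh n (k : ℕ))).prod).prod

/-- The left SOV covector
`⟨h| = (1/𝓃) ⟨0| ∏_{n=1}^N ∏_{k_n=0}^{h_n−1} C(η_n^{(k_n)})/d(η_n^{(k_n+1)})`. -/
def lvec (η : ℂ) (m : Fin N → ℕ) (inh : Fin N → ℂ) (h : HIdx m) : HIdx m → ℂ :=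
  (nrm η m inh)⁻¹ • Matrix.vecMul (vac m) (leftOp η m inh h)

/-- The operator `∏_{n=1}^N ∏_{k_n=0}^{h_n−1} B(η_n^{(k_n)})/a(η_n^{(k_n)})`. -/
def rightOp (η : ℂ) (m : Fin N → ℕ) (inh : Fin N → ℂ) (h : HIdx m) :
    Matrix (HIdx m) (HIdx m) ℂ :=
  (List.ofFn fun n : Fin N =>
    (List.ofFn fun k : Fin (h n : ℕ) =>
      (af η m inh (etaK η m inh n (k : ℕ)))⁻¹ •
        EntB η m inh (etaK η m inh n (k : ℕ))).prod).prod

/-- The right SOV vector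
`|h⟩ = (1/𝓃) ∏_{n=1}^N ∏_{k_n=0}^{h_n−1} [B(η_n^{(k_n)})/a(η_n^{(k_n)})] |0⟩`. -/
def rvec (η : ℂ) (m : Fin N → ℕ) (inh : Fin N → ℂ) (h : HIdx m) : HIdx m → ℂ :=
  (nrm η m inh)⁻¹ • Matrix.mulVec (rightOp η m inh h) (vac m)

/-- `x + 1`, clamped inside `Fin (d+1)` (the clamped value only ever appears
multiplied by a vanishing coefficient). -/
def upIdx {d : ℕ} (x : Fin (d + 1)) : Fin (d + 1) :=
  if h : (x : ℕ) + 1 ≤ d then ⟨(x : ℕ) + 1, Nat.lt_succ_of_le h⟩ else x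

/-- `x − 1`, clamped inside `Fin (d+1)`. -/
def downIdx {d : ℕ} (x : Fin (d + 1)) : Fin (d + 1) :=
  ⟨(x : ℕ) - 1, lt_of_le_of_lt (Nat.sub_le _ _) x.isLt⟩

/-- `T_a^+(h) = (h₁,…,h_a+1,…,h_N)`. -/
def Tup (m : Fin N → ℕ) (h : HIdx m) (a : Fin N) : HIdx m :=
  Function.update h a (upIdx (h a))

/-- `T_a^-(h) = (h₁,…,h_a−1,…,h_N)`. -/
def Tdown (m : Fin N → ℕ) (h : HIdx m) (a : Fin N) : HIdx m :=
  Function.update h a (downIdx (h a))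

/-- The Pauli matrix `σ^x`. -/
def sigmaX : Matrix (Fin 2) (Fin 2) ℂ := !![0, 1; 1, 0]

/-- `Σ^x`: the `(m+1)×(m+1)` matrix with ones on the antidiagonal. -/
def SigX (m : ℕ) : Matrix (Fin (m + 1)) (Fin (m + 1)) ℂ :=
  Matrix.of fun i j => if (i : ℕ) + (j : ℕ) = m then 1 else 0

/-- `σ^x ⊗ Σ^x` on `ℂ² ⊗ ℂ^{m+1}`. -/
def flip1 (m : ℕ) : Matrix (Fin 2 × Fin (m + 1)) (Fin 2 × Fin (m + 1)) ℂ :=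
  Matrix.of fun p q => sigmaX p.1 q.1 * SigX m p.2 q.2

/-- `σ^x₀ ⊗ Σ^x` on `ℂ² ⊗ H`, with `Σ^x = ⊗_{a=1}^N Σ^x_a`. -/
def bigFlip (m : Fin N → ℕ) : Matrix (Fin 2 × HIdx m) (Fin 2 × HIdx m) ℂ :=
  Matrix.of fun p q => sigmaX p.1 q.1 * ∏ n, SigX (m n) (p.2 n) (q.2 n)

/-- The tridiagonal matrix `D_n(t)` with diagonal `t(η_n^{(i)})`, superdiagonal
`−a(η_n^{(i)})` and subdiagonal `−d(η_n^{(i)})`. -/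
def Dmat (η : ℂ) (m : Fin N → ℕ) (inh : Fin N → ℂ) (t : ℂ → ℂ) (n : Fin N) :
    Matrix (Fin (m n + 1)) (Fin (m n + 1)) ℂ :=
  Matrix.of fun i j =>
    if (i : ℕ) = (j : ℕ) then t (etaK η m inh n i)
    else if (i : ℕ) + 1 = (j : ℕ) then -af η m inh (etaK η m inh n i)
    else if (j : ℕ) + 1 = (i : ℕ) then -df η m inh (etaK η m inh n i)
    else 0

/-- The local lowering operator `S_n^-` acting on the `n`-th factor of `H`. -/
def SnMinus (m : Fin N → ℕ) (n : Fin N) : Matrix (HIdx m) (HIdx m) ℂ :=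
  Matrix.of fun f g =>
    Sminus (m n) (f n) (g n) * (if ∀ k, k ≠ n → f k = g k then 1 else 0)

/-- `η̄_n^{(x)} = η_n + (x − s_n − 1/2)η` for (half-integer) `x`. -/
def etaBar (η : ℂ) (m : Fin N → ℕ) (inh : Fin N → ℂ) (n : Fin N) (x : ℂ) : ℂ :=
  inh n + (x - (m n : ℂ) / 2 - 1 / 2) * η


section RTT

variable {𝒜 ℬ : Type*} [Ring 𝒜] [Algebra ℂ 𝒜] [Ring ℬ] [Algebra ℂ ℬ]

/-- The Yang–Baxter relation `R(x) L₁ L'₂ = L'₂ L₁ R(x)`, entry by entry, for the rational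
R-matrix `R(x) = x + ηP`. -/
def RTT (x η : ℂ) (L L' : Matrix (Fin 2) (Fin 2) 𝒜) : Prop :=
  ∀ i j k l, x • (L i j * L' k l) + η • (L k j * L' i l)
    = x • (L' k l * L i j) + η • (L' k j * L i l)

theorem RTT.map {x η : ℂ} {L L' : Matrix (Fin 2) (Fin 2) 𝒜} (h : RTT x η L L')
    (φ : 𝒜 →ₐ[ℂ] ℬ) : RTT x η (L.map φ) (L'.map φ) := fun i j k l => by
  simpa only [map_add, map_smul, map_mul, Matrix.map_apply] using congrArg φ (h i j k l)

theorem RTT.one (x η : ℂ) : RTT x η (1 : Matrix (Fin 2) (Fin 2) 𝒜) 1 := fun i j k l => by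
  fin_cases i <;> fin_cases j <;> fin_cases k <;> fin_cases l <;> simp

/-- Product of an entry of `L * K` with an entry of `L' * K'`, reordered site by site. -/
theorem mul_apply_mul_mul_apply {𝒜 : Type*} [Ring 𝒜] {L K L' K' : Matrix (Fin 2) (Fin 2) 𝒜}
    (h : ∀ a b c d, Commute (K a b) (L' c d)) (i j k l : Fin 2) :
    (L * K) i j * (L' * K') k l = ∑ a, ∑ b, L i a * L' k b * (K a j * K' b l) := by
  rw [Matrix.mul_apply, Matrix.mul_apply, Finset.sum_mul_sum]
  refine Finset.sum_congr rfl fun a _ => Finset.sum_congr rfl fun b _ => ?_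
  rw [mul_assoc, ← mul_assoc (K a j), (h a j k b).eq]
  simp only [mul_assoc]

theorem RTT.mul {x η : ℂ} {L L' K K' : Matrix (Fin 2) (Fin 2) 𝒜}
    (hL : RTT x η L L') (hK : RTT x η K K')
    (h : ∀ a b c d, Commute (K a b) (L' c d)) (h' : ∀ a b c d, Commute (K' a b) (L c d)) :
    RTT x η (L * K) (L' * K') := by
  intro i j k l
  simp only [mul_apply_mul_mul_apply h, mul_apply_mul_mul_apply h']
  calc _ = ∑ a, ∑ b, (x • (L i a * L' k b) + η • (L k a * L' i b)) * (K a j * K' b l) := by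
        simp only [Finset.smul_sum, ← Finset.sum_add_distrib, add_mul, smul_mul_assoc]
    _ = ∑ a, ∑ b, x • (L' k b * L i a * (K a j * K' b l))
          + ∑ a, ∑ b, η • (L' k a * L i b * (K a j * K' b l)) := by
        simp only [hL i _ k _, ← Finset.sum_add_distrib, add_mul, smul_mul_assoc]
    _ = ∑ a, ∑ b, L' k a * L i b * (x • (K b j * K' a l) + η • (K a j * K' b l)) := by
        rw [Finset.sum_comm]
        simp only [← Finset.sum_add_distrib, mul_add, mul_smul_comm]
    _ = _ := by
        simp only [hK _ j _ l, Finset.smul_sum, ← Finset.sum_add_distrib, mul_add, mul_smul_comm]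

/-- The sums of the off-diagonal entries at two spectral parameters commute. -/
theorem RTT.commute_offDiag {x η : ℂ} {T T' : Matrix (Fin 2) (Fin 2) 𝒜} (hx : x ≠ 0)
    (h : RTT x η T T') (h' : RTT (-x) η T' T) :
    Commute (T 0 1 + T 1 0) (T' 0 1 + T' 1 0) := by
  have diag (i j : Fin 2) : T i j * T' i j = T' i j * T i j := by
    have e : (x + η) • (T i j * T' i j - T' i j * T i j) = 0 := by
      rw [smul_sub, add_smul, add_smul, h i j i j, sub_self]
    have e' : (-x + η) • (T i j * T' i j - T' i j * T i j) = 0 := by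
      rw [smul_sub, add_smul, add_smul, h' i j i j, sub_self]
    have e2 : (2 * x) • (T i j * T' i j - T' i j * T i j) = 0 := by
      rw [show 2 * x = (x + η) - (-x + η) by ring, sub_smul, e, e', sub_zero]
    exact sub_eq_zero.mp ((smul_eq_zero_iff_right (mul_ne_zero two_ne_zero hx)).mp e2)
  have e1 := h 0 1 1 0
  have e2 := h 1 0 0 1
  have e3 := h 0 0 1 1
  have e4 := h' 0 0 1 1
  have cross : T 0 1 * T' 1 0 + T 1 0 * T' 0 1 = T' 1 0 * T 0 1 + T' 0 1 * T 1 0 := by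
    have e : x • x • (T 0 1 * T' 1 0 + T 1 0 * T' 0 1 - (T' 1 0 * T 0 1 + T' 0 1 * T 1 0)) = 0 := by
      linear_combination (norm := module) x • e1 + x • e2 - η • e3 - η • e4
    exact sub_eq_zero.mp
      ((smul_eq_zero_iff_right hx).mp ((smul_eq_zero_iff_right hx).mp e))
  have d1 := diag 0 1
  have d2 := diag 1 0
  rw [commute_iff_eq]
  simp only [add_mul, mul_add, d1, d2]
  linear_combination (norm := abel) cross

/-- The entries of `T'` are, up to the sign `c`, the adjoints of those of `σʸ T σʸ`. -/
structure IsCrossAdjoint [StarRing 𝒜] (c : ℂ) (T T' : Matrix (Fin 2) (Fin 2) 𝒜) : Prop where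
  zero_zero : star (T 0 0) = c • T' 1 1
  zero_one : star (T 0 1) = -(c • T' 1 0)
  one_zero : star (T 1 0) = -(c • T' 0 1)
  one_one : star (T 1 1) = c • T' 0 0

theorem IsCrossAdjoint.mul [StarRing 𝒜] {c d : ℂ} {L L' K K' : Matrix (Fin 2) (Fin 2) 𝒜}
    (hL : IsCrossAdjoint c L L') (hK : IsCrossAdjoint d K K')
    (h : ∀ i j k l, Commute (K' i j) (L' k l)) :
    IsCrossAdjoint (c * d) (L * K) (L' * K') := by
  constructor <;>
    simp only [Matrix.mul_apply, Fin.sum_univ_two, star_add, star_mul, hL.zero_zero, hL.zero_one,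
      hL.one_zero, hL.one_one, hK.zero_zero, hK.zero_one, hK.one_zero, hK.one_one, smul_mul_assoc,
      mul_smul_comm, neg_mul, mul_neg, (h _ _ _ _).eq, smul_add, smul_smul, neg_neg, smul_neg, neg_add] <;>
    exact add_comm _ _

end RTT

section Spin

theorem Sz_mul_Splus_sub (m : ℕ) : Sz m * Splus m - Splus m * Sz m = Splus m := by
  ext i j
  simp only [Sz, Splus, Matrix.sub_apply, Matrix.diagonal_mul, Matrix.mul_diagonal,
    Matrix.of_apply]
  split_ifs with h
  · rw [← h]; push_cast; ring
  · ring

theorem Sz_mul_Sminus_sub (m : ℕ) : Sz m * Sminus m - Sminus m * Sz m = -Sminus m := by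
  have h := congrArg Matrix.transpose (Sz_mul_Splus_sub m)
  have hz : (Sz m)ᵀ = Sz m := Matrix.diagonal_transpose _
  rw [Matrix.transpose_sub, Matrix.transpose_mul, Matrix.transpose_mul, hz] at h
  rw [Sminus, ← neg_sub, h]

theorem ladder_coeff_mul_self {m k : ℕ} (hk : k ≤ m) :
    ((√((k + 1) * (m - k)) : ℝ) : ℂ) * (√((k + 1) * (m - k)) : ℝ) = ((k : ℂ) + 1) * (m - k) := by
  have hk' : (k : ℝ) ≤ m := mod_cast hk
  rw [← Complex.ofReal_mul, Real.mul_self_sqrt (mul_nonneg (by positivity) (sub_nonneg.mpr hk'))]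
  push_cast
  rfl

theorem Splus_mul_Sminus (m : ℕ) :
    Splus m * Sminus m = Matrix.diagonal fun i : Fin (m + 1) => (((i : ℕ) : ℂ) + 1) * (m - (i : ℕ)) := by
  ext i j
  simp only [Splus, Sminus, Matrix.mul_apply, Matrix.transpose_apply, Matrix.of_apply,
    Matrix.diagonal_apply]
  split_ifs with hij
  · subst hij
    rcases (Nat.lt_succ_iff.mp i.2).lt_or_eq with hi | hi
    · rw [Finset.sum_eq_single ⟨i + 1, by omega⟩]
      · simp only [if_true, ladder_coeff_mul_self hi.le]
      · intro b _ hb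
        rw [if_neg fun h => hb (Fin.ext h.symm), zero_mul]
      · simp
    · rw [Finset.sum_eq_zero fun b _ => by rw [if_neg (by omega), zero_mul], hi]
      simp
  · refine Finset.sum_eq_zero fun b _ => ?_
    split_ifs with h1 h2
    · exact absurd (Fin.ext (by omega)) hij
    all_goals simp

theorem Sminus_mul_Splus (m : ℕ) :
    Sminus m * Splus m = Matrix.diagonal fun i : Fin (m + 1) => ((i : ℕ) : ℂ) * (m + 1 - (i : ℕ)) := by
  ext i j
  simp only [Splus, Sminus, Matrix.mul_apply, Matrix.transpose_apply, Matrix.of_apply,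
    Matrix.diagonal_apply]
  split_ifs with hij
  · subst hij
    rcases Nat.eq_zero_or_eq_succ_pred (i : ℕ) with hi | hi
    · rw [Finset.sum_eq_zero fun b _ => by rw [if_neg (by omega), zero_mul], hi]
      simp
    · have hm : (i : ℕ).pred ≤ m := by have := i.2; omega
      rw [Finset.sum_eq_single ⟨(i : ℕ).pred, by omega⟩]
      · simp only [if_pos hi.symm, ladder_coeff_mul_self hm]
        rw [show ((i : ℕ) : ℂ) = ((i : ℕ).pred : ℕ) + 1 from mod_cast hi]
        ring
      · intro b _ hb
        rw [if_neg fun h => hb (Fin.ext (by simp only; omega)), zero_mul]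
      · simp
  · refine Finset.sum_eq_zero fun b _ => ?_
    split_ifs with h1 h2
    · exact absurd (Fin.ext (by omega)) hij
    all_goals simp

theorem Splus_mul_Sminus_sub (m : ℕ) :
    Splus m * Sminus m - Sminus m * Splus m = (2 : ℂ) • Sz m := by
  rw [Splus_mul_Sminus, Sminus_mul_Splus, Sz, Matrix.diagonal_sub, ← Matrix.diagonal_smul]
  congr 1
  ext i
  simp only [Pi.smul_apply, smul_eq_mul]
  ring

/-- The Lax operator as a `2 × 2` matrix of operators on the spin space. -/
def laxBlock (η : ℂ) (m : ℕ) (lam : ℂ) :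
    Matrix (Fin 2) (Fin 2) (Matrix (Fin (m + 1)) (Fin (m + 1)) ℂ) :=
  !![(lam + η / 2) • 1 + η • Sz m, η • Sminus m; η • Splus m, (lam + η / 2) • 1 - η • Sz m]

theorem laxBlock_apply (η : ℂ) (m : ℕ) (lam : ℂ) (i j : Fin 2) (a b : Fin (m + 1)) :
    laxBlock η m lam i j a b = Lax η m lam (i, a) (j, b) := by
  fin_cases i <;> fin_cases j <;> rfl

theorem rtt_laxBlock (η : ℂ) (m : ℕ) (lam mu : ℂ) :
    RTT (lam - mu) η (laxBlock η m lam) (laxBlock η m mu) := by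
  have h1 := sub_eq_iff_eq_add.mp (Sz_mul_Splus_sub m)
  have h2 := sub_eq_iff_eq_add.mp (Sz_mul_Sminus_sub m)
  have h3 := sub_eq_iff_eq_add.mp (Splus_mul_Sminus_sub m)
  intro i j k l
  fin_cases i <;> fin_cases j <;> fin_cases k <;> fin_cases l <;>
    simp only [laxBlock, Fin.zero_eta, Fin.mk_one, Matrix.of_apply, Matrix.cons_val_zero,
      Matrix.cons_val_one, Matrix.cons_val', add_mul, mul_add, sub_mul, mul_sub, smul_mul_assoc,
      mul_smul_comm, one_mul, mul_one, h1, h2, h3] <;>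
    module

theorem isCrossAdjoint_laxBlock {η : ℂ} (hη : starRingEnd ℂ η = η) (m : ℕ) {lam mu : ℂ}
    (h : mu = -(starRingEnd ℂ lam + η)) :
    IsCrossAdjoint (-1) (laxBlock η m lam) (laxBlock η m mu) := by
  have hz : star (Sz m) = Sz m := by
    rw [Sz, Matrix.star_eq_conjTranspose, Matrix.diagonal_conjTranspose]
    congr 1
    ext i
    simp
  have hp : star (Splus m) = Sminus m := by
    ext i j
    simp only [Matrix.star_eq_conjTranspose, Matrix.conjTranspose_apply, Sminus,
      Matrix.transpose_apply, Splus, Matrix.of_apply]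
    split_ifs <;> simp
  have hm : star (Sminus m) = Splus m := by rw [← hp, star_star]
  have hη' : star η = η := hη
  have hl : star lam = -(mu + η) := by rw [h]; simp
  constructor <;>
    simp [laxBlock, hz, hp, hm, hη', hl, star_smul, star_div₀] <;> module

end Spin

section Chain

variable (m : Fin N → ℕ)

/-- The operator acting as `X` on the `n`-th factor of `H` and trivially elsewhere. -/
def localFun (n : Fin N) (X : Matrix (Fin (m n + 1)) (Fin (m n + 1)) ℂ) :
    Matrix (HIdx m) (HIdx m) ℂ :=
  Matrix.of fun f g => X (f n) (g n) * (if ∀ k, k ≠ n → f k = g k then 1 else 0)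

theorem localFun_one (n : Fin N) : localFun m n 1 = 1 := by
  ext f g
  by_cases h : f = g
  · subst h
    simp [localFun]
  · by_cases hn : f n = g n
    · have : ¬ ∀ k, k ≠ n → f k = g k := fun hk =>
        h (funext fun k => (eq_or_ne k n).elim (fun e => e ▸ hn) (hk k))
      simp only [localFun, Matrix.of_apply, if_neg this, mul_zero, Matrix.one_apply_ne h]
    · simp [localFun, Matrix.one_apply_ne h, Matrix.one_apply_ne hn]

theorem localFun_mul (n : Fin N) (X Y : Matrix (Fin (m n + 1)) (Fin (m n + 1)) ℂ) :
    localFun m n (X * Y) = localFun m n X * localFun m n Y := by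
  ext f g
  simp only [localFun, Matrix.mul_apply, Matrix.of_apply, Finset.sum_mul]
  refine Fintype.sum_of_injective (Function.update f n) (Function.update_injective f n) _ _ ?_ ?_
  · intro h hh
    have : ¬ ∀ k, k ≠ n → f k = h k := fun hk => hh ⟨h n, by
      ext1 k
      rcases eq_or_ne k n with rfl | e
      · simp
      · simp [e, hk k e]⟩
    simp [this]
  · intro c
    have h1 : ∀ k, k ≠ n → f k = Function.update f n c k := fun k hk => by simp [hk]
    have h2 : (∀ k, k ≠ n → Function.update f n c k = g k) ↔ ∀ k, k ≠ n → f k = g k :=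
      forall₂_congr fun k hk => by rw [← h1 k hk]
    simp only [if_pos h1, h2, Function.update_self, mul_one, mul_assoc]

theorem localFun_mul_localFun_apply {n k : Fin N} (hnk : n ≠ k)
    (X : Matrix (Fin (m n + 1)) (Fin (m n + 1)) ℂ) (Y : Matrix (Fin (m k + 1)) (Fin (m k + 1)) ℂ)
    (f g : HIdx m) :
    (localFun m n X * localFun m k Y) f g =
      X (f n) (g n) * Y (f k) (g k) * (if ∀ j, j ≠ n → j ≠ k → f j = g j then 1 else 0) := by
  rw [Matrix.mul_apply, Finset.sum_eq_single (Function.update f n (g n))]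
  · have h1 : ∀ j, j ≠ n → f j = Function.update f n (g n) j := fun j hj => by simp [hj]
    have h2 : (∀ j, j ≠ k → Function.update f n (g n) j = g j) ↔
        ∀ j, j ≠ n → j ≠ k → f j = g j := by
      refine ⟨fun h j hn hk => (h1 j hn).trans (h j hk), fun h j hk => ?_⟩
      rcases eq_or_ne j n with rfl | hn
      · simp
      · rw [← h1 j hn, h j hn hk]
    simp only [localFun, Matrix.of_apply, if_pos h1, h2, Function.update_self, mul_one,
      ← h1 k hnk.symm, mul_assoc]
  · intro h _ hne
    by_cases h1 : ∀ j, j ≠ n → f j = h j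
    · have h2 : ¬ ∀ j, j ≠ k → h j = g j := fun h2 => hne (by
        ext1 j
        rcases eq_or_ne j n with rfl | hn
        · simp [h2 j hnk]
        · simp [hn, h1 j hn])
      simp only [localFun, Matrix.of_apply, if_neg h2, mul_zero]
    · simp only [localFun, Matrix.of_apply, if_neg h1, mul_zero, zero_mul]
  · simp

/-- `localFun` as an algebra homomorphism. -/
def localOp (n : Fin N) :
    Matrix (Fin (m n + 1)) (Fin (m n + 1)) ℂ →ₐ[ℂ] Matrix (HIdx m) (HIdx m) ℂ :=
  AlgHom.ofLinearMap
    { toFun := localFun m n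
      map_add' := fun X Y => by ext f g; simp only [localFun, Matrix.add_apply, Matrix.of_apply, add_mul]
      map_smul' := fun c X => by ext f g; simp [localFun] }
    (localFun_one m n) (localFun_mul m n)

theorem localOp_apply (n : Fin N) (X : Matrix (Fin (m n + 1)) (Fin (m n + 1)) ℂ) (f g : HIdx m) :
    localOp m n X f g = X (f n) (g n) * (if ∀ k, k ≠ n → f k = g k then 1 else 0) := rfl

theorem star_localOp (n : Fin N) (X : Matrix (Fin (m n + 1)) (Fin (m n + 1)) ℂ) :
    star (localOp m n X) = localOp m n (star X) := by
  ext f g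
  simp only [Matrix.star_apply, localOp_apply, star_mul', eq_comm (a := g _)]
  split_ifs <;> simp

theorem commute_localOp {n k : Fin N} (hnk : n ≠ k)
    (X : Matrix (Fin (m n + 1)) (Fin (m n + 1)) ℂ)
    (Y : Matrix (Fin (m k + 1)) (Fin (m k + 1)) ℂ) :
    Commute (localOp m n X) (localOp m k Y) := by
  ext f g
  refine (localFun_mul_localFun_apply m hnk X Y f g).trans
    (.trans ?_ (localFun_mul_localFun_apply m hnk.symm Y X f g).symm)
  have : (∀ j, j ≠ n → j ≠ k → f j = g j) ↔ ∀ j, j ≠ k → j ≠ n → f j = g j :=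
    forall_congr' fun j => imp.swap
  simp only [this, mul_comm (X _ _)]

theorem IsCrossAdjoint.map_localOp {c : ℂ} {n : Fin N}
    {L L' : Matrix (Fin 2) (Fin 2) (Matrix (Fin (m n + 1)) (Fin (m n + 1)) ℂ)}
    (h : IsCrossAdjoint c L L') :
    IsCrossAdjoint c (L.map (localOp m n)) (L'.map (localOp m n)) := by
  constructor <;>
    simp only [Matrix.map_apply, star_localOp, h.zero_zero, h.zero_one, h.one_zero, h.one_one,
      map_neg, map_smul]

variable (η : ℂ) (inh : Fin N → ℂ)

/-- The Lax operator at site `n` as a `2 × 2` matrix of operators on `H`. -/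
def siteBlock (lam : ℂ) (n : Fin N) : Matrix (Fin 2) (Fin 2) (Matrix (HIdx m) (HIdx m) ℂ) :=
  (laxBlock η (m n) (lam - inh n)).map (localOp m n)

/-- The ordered product of the Lax operators over a list of sites. -/
def chain (lam : ℂ) (l : List (Fin N)) : Matrix (Fin 2) (Fin 2) (Matrix (HIdx m) (HIdx m) ℂ) :=
  (l.map (siteBlock m η inh lam)).prod

theorem commute_chain_siteBlock (lam mu : ℂ) {n : Fin N} {l : List (Fin N)} (hn : n ∉ l)
    (i j a b : Fin 2) :
    Commute (chain m η inh lam l i j) (siteBlock m η inh mu n a b) := by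
  induction l generalizing i j with
  | nil =>
    rw [chain, List.map_nil, List.prod_nil, Matrix.one_apply]
    split_ifs
    exacts [Commute.one_left _, Commute.zero_left _]
  | cons k l ih =>
    rw [List.mem_cons, not_or] at hn
    rw [chain, List.map_cons, List.prod_cons, Matrix.mul_apply]
    exact Commute.sum_left _ _ _ fun c _ =>
      (commute_localOp m (Ne.symm hn.1) _ _).mul_left (ih hn.2 c j)

theorem rtt_chain (lam mu : ℂ) {l : List (Fin N)} (hl : l.Nodup) :
    RTT (lam - mu) η (chain m η inh lam l) (chain m η inh mu l) := by
  induction l with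
  | nil => exact RTT.one _ _
  | cons n l ih =>
    rw [List.nodup_cons] at hl
    have hn : RTT (lam - mu) η (siteBlock m η inh lam n) (siteBlock m η inh mu n) := by
      simpa only [siteBlock, sub_sub_sub_cancel_right] using
        (rtt_laxBlock η (m n) (lam - inh n) (mu - inh n)).map (localOp m n)
    exact hn.mul (ih hl.2) (commute_chain_siteBlock m η inh _ _ hl.1)
      (commute_chain_siteBlock m η inh _ _ hl.1)

variable {η inh}

theorem isCrossAdjoint_chain (hη : η.im = 0) (hinh : ∀ n, (inh n).re = 0) (lam : ℂ)
    {l : List (Fin N)} (hl : l.Nodup) :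
    IsCrossAdjoint ((-1) ^ l.length) (chain m η inh lam l)
      (chain m η inh (-(starRingEnd ℂ lam + η)) l) := by
  induction l with
  | nil => constructor <;> simp [chain]
  | cons n l ih =>
    rw [List.nodup_cons] at hl
    rw [List.length_cons, pow_succ']
    refine IsCrossAdjoint.mul (IsCrossAdjoint.map_localOp m (isCrossAdjoint_laxBlock
      (Complex.conj_eq_iff_im.mpr hη) _ ?_)) (ih hl.2) (commute_chain_siteBlock m η inh _ _ hl.1)
    have : starRingEnd ℂ (inh n) = -inh n := by apply Complex.ext <;> simp [hinh n]
    rw [map_sub, this]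
    ring

variable (η inh)

theorem compRingEquiv_chain (lam : ℂ) :
    Matrix.compRingEquiv (Fin 2) (HIdx m) ℂ (chain m η inh lam (List.finRange N).reverse)
      = Mono η m inh lam := by
  rw [chain, Mono, map_list_prod, List.ofFn_eq_map, ← List.map_reverse, List.map_map]
  congr 2

theorem chain_apply (lam : ℂ) (i j : Fin 2) :
    chain m η inh lam (List.finRange N).reverse i j
      = Matrix.of fun f g => Mono η m inh lam (i, f) (j, g) := by
  rw [← compRingEquiv_chain]
  rfl

theorem commute_Tbar (lam mu : ℂ) : Commute (Tbar η m inh lam) (Tbar η m inh mu) := by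
  rcases eq_or_ne lam mu with rfl | hne
  · exact Commute.refl _
  have hl : (List.finRange N).reverse.Nodup := List.nodup_reverse.mpr (List.nodup_finRange N)
  have h := (rtt_chain m η inh lam mu hl).commute_offDiag (sub_ne_zero.mpr hne)
    (by simpa only [neg_sub] using rtt_chain m η inh mu lam hl)
  simp only [chain_apply] at h
  exact h

end Chain

/-- For real `η` and purely imaginary inhomogeneities, `T̄(λ)` is
normal for every `λ`, `i^{e_N}·T̄(λ)` is self-adjoint whenever `λ + λ̄ + η = 0`
(where `e_N = 1` for `N` even and `e_N = 0` for `N` odd), and the Hermitian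
conjugates of the monodromy entries are `A(λ)† = (−1)^N D(−(λ̄+η))`,
`B(λ)† = −(−1)^N C(−(λ̄+η))`, `C(λ)† = −(−1)^N B(−(λ̄+η))`,
`D(λ)† = (−1)^N A(−(λ̄+η))`. -/
theorem transfer_normal_selfadjoint_real_eta
    {N : ℕ} (hN : 1 ≤ N) (η : ℂ) (m : Fin N → ℕ) (hm : ∀ n, 1 ≤ m n)
    (inh : Fin N → ℂ) (hη : η.im = 0) (hinh : ∀ n, (inh n).re = 0) :
    (∀ lam : ℂ,
      (Tbar η m inh lam)ᴴ * Tbar η m inh lam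
        = Tbar η m inh lam * (Tbar η m inh lam)ᴴ)
    ∧ (∀ lam : ℂ, lam + (starRingEnd ℂ) lam + η = 0 →
        ((Complex.I ^ (if Even N then 1 else 0)) • Tbar η m inh lam).IsHermitian)
    ∧ (∀ lam : ℂ,
        (EntA η m inh lam)ᴴ
            = ((-1 : ℂ) ^ N) • EntD η m inh (-((starRingEnd ℂ) lam + η))
        ∧ (EntB η m inh lam)ᴴ
            = -(((-1 : ℂ) ^ N) • EntC η m inh (-((starRingEnd ℂ) lam + η)))
        ∧ (EntC η m inh lam)ᴴ
            = -(((-1 : ℂ) ^ N) • EntB η m inh (-((starRingEnd ℂ) lam + η)))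
        ∧ (EntD η m inh lam)ᴴ
            = ((-1 : ℂ) ^ N) • EntA η m inh (-((starRingEnd ℂ) lam + η))) := by
  have adj (lam : ℂ) := isCrossAdjoint_chain m hη hinh lam
    (List.nodup_reverse.mpr (List.nodup_finRange N))
  simp only [List.length_reverse, List.length_finRange] at adj
  have hT (lam : ℂ) : (Tbar η m inh lam)ᴴ
      = -((-1 : ℂ) ^ N • Tbar η m inh (-(starRingEnd ℂ lam + η))) := by
    have h01 := (adj lam).zero_one
    have h10 := (adj lam).one_zero
    simp only [chain_apply] at h01 h10
    rw [Tbar, Tbar, Matrix.conjTranspose_add, smul_add, neg_add_rev]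
    exact congrArg₂ _ h01 h10
  refine ⟨fun lam => ?_, fun lam hlam => ?_, fun lam => ?_⟩
  · rw [hT]
    exact (((commute_Tbar m η inh _ lam).smul_left _).neg_left).eq
  · rw [Matrix.IsHermitian, Matrix.conjTranspose_smul, hT,
      show -(starRingEnd ℂ lam + η) = lam by linear_combination -hlam, smul_neg, smul_smul,
      ← neg_smul]
    congr 1
    split_ifs with hE
    · simp [hE.neg_one_pow]
    · simp [(Nat.not_even_iff_odd.mp hE).neg_one_pow]
  · obtain ⟨h1, h2, h3, h4⟩ := adj lam
    simp only [chain_apply] at h1 h2 h3 h4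
    exact ⟨h1, h2, h3, h4⟩

end AntiperiodicXXX
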